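/- arXiv:2011.14335 — 4 statements merged into one kernel-verified Lean document; each statement's English description precedes it below -/
import Mathlib

section
/- Let S be a pseudogroup and let A be a (semigroup) ideal of S. Then A^∨, the set of all joins of compatible subsets of A, is a sup-ideal of S (an ideal closed under arbitrary compatible joins). -/
namespace PseudogroupMorita

/-- An inverse semigroup: a semigroup in which every element `a` has a unique
inverse `a⁻¹` satisfying `a * a⁻¹ * a = a` and `a⁻¹ * a * a⁻¹ = a⁻¹`. -/
class InverseSemigroup (S : Type*) extends Semigroup S, Inv S where
  mul_inv_mul : ∀ a : S, a * a⁻¹ * a = a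
  inv_mul_inv : ∀ a : S, a⁻¹ * a * a⁻¹ = a⁻¹
  inv_unique : ∀ a b : S, a * b * a = a → b * a * b = b → b = a⁻¹

/-- `a` is an idempotent. -/
def IsIdem {S : Type*} [Mul S] (a : S) : Prop := a * a = a

/-- The natural partial order: `a ≤ b` iff `a = e * b` for some idempotent `e`. -/
def nle {S : Type*} [Mul S] (a b : S) : Prop := ∃ e : S, IsIdem e ∧ a = e * b

/-- `s` and `t` are left compatible: `s⁻¹ * t` is an idempotent. -/
def LeftCompat {S : Type*} [Mul S] [Inv S] (s t : S) : Prop := IsIdem (s⁻¹ * t)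

/-- `s` and `t` are right compatible: `s * t⁻¹` is an idempotent. -/
def RightCompat {S : Type*} [Mul S] [Inv S] (s t : S) : Prop := IsIdem (s * t⁻¹)

/-- `s` and `t` are compatible. -/
def Compat {S : Type*} [Mul S] [Inv S] (s t : S) : Prop := LeftCompat s t ∧ RightCompat s t

/-- A compatible subset: any two of its elements are compatible. -/
def CompatSet {S : Type*} [Mul S] [Inv S] (A : Set S) : Prop := ∀ a ∈ A, ∀ b ∈ A, Compat a b

/-- `j` is the join (least upper bound) of `A` with respect to the natural partial order. -/
def IsJoin {S : Type*} [Mul S] (A : Set S) (j : S) : Prop :=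
  (∀ a ∈ A, nle a j) ∧ ∀ b : S, (∀ a ∈ A, nle a b) → nle j b

/-- A pseudogroup: an inverse semigroup in which every compatible subset has a join
and multiplication distributes over such joins. -/
class Pseudogroup (S : Type*) extends InverseSemigroup S where
  joins_exist : ∀ A : Set S, CompatSet A → ∃ j : S, IsJoin A j
  mul_join_left : ∀ (s : S) (A : Set S) (j : S), CompatSet A → IsJoin A j →
    IsJoin ((fun a => s * a) '' A) (s * j)
  mul_join_right : ∀ (s : S) (A : Set S) (j : S), CompatSet A → IsJoin A j →
    IsJoin ((fun a => a * s) '' A) (j * s)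

/-- `A^∨`: the set of all joins of compatible subsets of `A`. -/
def supClosure {S : Type*} [Mul S] [Inv S] (A : Set S) : Set S :=
  {j | ∃ C : Set S, C ⊆ A ∧ CompatSet C ∧ IsJoin C j}

/-- The underlying set of the local semigroup `eSe`. -/
def locSet {S : Type*} [Mul S] (e : S) : Set S := {u : S | u = e * u * e}

/-- The set `A * B * C` of triple products. -/
def tripleProd {S : Type*} [Mul S] (A B C : Set S) : Set S :=
  {x : S | ∃ a ∈ A, ∃ b ∈ B, ∃ c ∈ C, x = a * b * c}

/-- A (two-sided) semigroup ideal. -/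
def SemigroupIdeal {S : Type*} [Mul S] (I : Set S) : Prop :=
  ∀ s : S, ∀ a ∈ I, s * a ∈ I ∧ a * s ∈ I

/-- A sup-ideal: an ideal closed under arbitrary compatible joins. -/
def IsSupIdeal {S : Type*} [Mul S] [Inv S] (I : Set S) : Prop :=
  SemigroupIdeal I ∧ ∀ C : Set S, C ⊆ I → CompatSet C → ∀ j : S, IsJoin C j → j ∈ I

/-- A pencil from `e` to `f`: a subset `X` with `e = ⋁_{x ∈ X} d x` and `f ≥ ⋁_{x ∈ X} r x`. -/
def IsPencil {S : Type*} [Mul S] [Inv S] (X : Set S) (e f : S) : Prop :=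
  IsJoin ((fun x => x⁻¹ * x) '' X) e ∧
  ∃ j : S, IsJoin ((fun x => x * x⁻¹) '' X) j ∧ nle j f

/-- `e ⪯ f` iff there is a pencil from `e` to `f`. -/
def PencilLE {S : Type*} [Mul S] [Inv S] (e f : S) : Prop := ∃ X : Set S, IsPencil X e f

/-- A sup-ideal of the (local) pseudogroup whose underlying set is `A`. -/
def IsSupIdealIn {S : Type*} [Mul S] [Inv S] (A I : Set S) : Prop :=
  I ⊆ A ∧ (∀ s ∈ A, ∀ a ∈ I, s * a ∈ I ∧ a * s ∈ I) ∧
  ∀ C : Set S, C ⊆ I → CompatSet C → ∀ j : S, IsJoin C j → j ∈ I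

/-- The (local) pseudogroup with underlying set `A` and least element `z` is 0-simplifying:
its only sup-ideals are `{z}` and `A` itself. -/
def ZeroSimplifyingIn {S : Type*} [Mul S] [Inv S] (A : Set S) (z : S) : Prop :=
  ∀ I : Set S, IsSupIdealIn A I → I = {z} ∨ I = A

/-- The (local) inverse semigroup with underlying set `A` is fundamental: any of its
elements commuting with all of its idempotents is an idempotent. -/
def FundamentalIn {S : Type*} [Mul S] (A : Set S) : Prop :=
  ∀ a ∈ A, (∀ g ∈ A, IsIdem g → a * g = g * a) → IsIdem a

/-- A supported left action of an inverse semigroup `S` on a set `X`. -/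
structure SupportedAction (S : Type*) [InverseSemigroup S] (X : Type*) where
  act : S → X → X
  act_mul : ∀ (s t : S) (x : X), act (s * t) x = act s (act t x)
  p : X → S
  p_idem : ∀ x : X, IsIdem (p x)
  p_act : ∀ x : X, act (p x) x = x
  p_conj : ∀ (s : S) (x : X), p (act s x) = s * p x * s⁻¹

namespace SupportedAction

variable {S : Type*} [InverseSemigroup S] {X Y : Type*}

/-- `x` and `y` are left compatible: `p(x) y = p(y) x`. -/
def LCompat (M : SupportedAction S X) (x y : X) : Prop :=
  M.act (M.p x) y = M.act (M.p y) x

/-- A left compatible subset of `X`. -/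
def LCompatSet (M : SupportedAction S X) (A : Set X) : Prop :=
  ∀ x ∈ A, ∀ y ∈ A, M.LCompat x y

/-- The order on `X`: `x ≤ y` iff `x = e • y` for some idempotent `e`. -/
def xle (M : SupportedAction S X) (x y : X) : Prop :=
  ∃ e : S, IsIdem e ∧ x = M.act e y

/-- `j` is the join of `A ⊆ X`. -/
def IsJoinX (M : SupportedAction S X) (A : Set X) (j : X) : Prop :=
  (∀ a ∈ A, M.xle a j) ∧ ∀ b : X, (∀ a ∈ A, M.xle a b) → M.xle j b

/-- `m` is the (binary) meet of `x` and `y` in `X`. -/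
def IsMeetX (M : SupportedAction S X) (x y m : X) : Prop :=
  M.xle m x ∧ M.xle m y ∧ ∀ z : X, M.xle z x → M.xle z y → M.xle z m

/-- The action is pointed, with minimum `z ∈ X` and `zS` the least element of `S`:
`s • z = z` and `zS • x = z`. -/
def Pointed (M : SupportedAction S X) (z : X) (zS : S) : Prop :=
  (∀ x : X, M.xle z x) ∧ (∀ s : S, M.act s z = z) ∧ (∀ x : X, M.act zS x = z)

/-- A homomorphism of supported left `S`-actions. -/
def IsActHom (M : SupportedAction S X) (N : SupportedAction S Y) (θ : X → Y) : Prop :=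
  (∀ (s : S) (x : X), θ (M.act s x) = N.act s (θ x)) ∧ ∀ x : X, N.p (θ x) = M.p x

end SupportedAction

/-- A left `S`-module over a pseudogroup `S`: a supported left action such that every
left compatible subset of `X` has a join, the action distributes over left compatible
joins, and joins of compatible subsets of `S` act as joins. -/
structure SMod (S : Type*) [Pseudogroup S] (X : Type*) extends SupportedAction S X where
  joinsX : ∀ A : Set X, toSupportedAction.LCompatSet A → ∃ j : X, toSupportedAction.IsJoinX A j
  act_joinX : ∀ (s : S) (A : Set X) (j : X), toSupportedAction.LCompatSet A →
    toSupportedAction.IsJoinX A j →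
    toSupportedAction.IsJoinX (toSupportedAction.act s '' A) (toSupportedAction.act s j)
  join_act : ∀ (A : Set S) (j : S), CompatSet A → IsJoin A j → ∀ x : X,
    toSupportedAction.IsJoinX ((fun s => toSupportedAction.act s x) '' A)
      (toSupportedAction.act j x)

/-- A homomorphism of left `S`-modules: a homomorphism of the underlying supported
actions preserving all left compatible joins. -/
def IsModHom {S X Y : Type*} [Pseudogroup S] (M : SMod S X) (N : SMod S Y) (θ : X → Y) : Prop :=
  SupportedAction.IsActHom M.toSupportedAction N.toSupportedAction θ ∧
  ∀ (A : Set X) (j : X), M.toSupportedAction.LCompatSet A → M.toSupportedAction.IsJoinX A j →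
    N.toSupportedAction.IsJoinX (θ '' A) (θ j)

/-- `L(X)`: the set of left compatible order-ideals of a supported action `X`. -/
abbrev LIdeal {S : Type*} [InverseSemigroup S] {X : Type*} (M : SupportedAction S X) : Type _ :=
  {A : Set X // (∀ x y : X, M.xle x y → y ∈ A → x ∈ A) ∧ M.LCompatSet A}

/-- An `(S,T)`-biaction with inner products. -/
structure Biaction (S T : Type*) [InverseSemigroup S] [InverseSemigroup T] (X : Type*) where
  actL : S → X → X
  actL_mul : ∀ (s t : S) (x : X), actL (s * t) x = actL s (actL t x)
  actR : X → T → X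
  actR_mul : ∀ (x : X) (t u : T), actR x (t * u) = actR (actR x t) u
  actLR : ∀ (s : S) (x : X) (t : T), actR (actL s x) t = actL s (actR x t)
  ip : X → X → S
  iq : X → X → T
  ip_actL : ∀ (s : S) (x y : X), ip (actL s x) y = s * ip x y
  ip_symm : ∀ x y : X, ip y x = (ip x y)⁻¹
  ip_self_act : ∀ x : X, actL (ip x x) x = x
  iq_actR : ∀ (x y : X) (t : T), iq x (actR y t) = iq x y * t
  iq_symm : ∀ x y : X, iq y x = (iq x y)⁻¹
  iq_self_act : ∀ x : X, actR x (iq x x) = x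
  ip_iq_assoc : ∀ x y z : X, actL (ip x y) z = actR x (iq y z)

namespace Biaction

variable {S T : Type*} [InverseSemigroup S] [InverseSemigroup T] {X : Type*}

/-- Left compatibility in a biaction: `p(x) y = p(y) x` with `p x = ⟨x,x⟩`. -/
def LCompatX (B : Biaction S T X) (x y : X) : Prop :=
  B.actL (B.ip x x) y = B.actL (B.ip y y) x

/-- Right compatibility in a biaction: `x q(y) = y q(x)` with `q x = [x,x]`. -/
def RCompatX (B : Biaction S T X) (x y : X) : Prop :=
  B.actR x (B.iq y y) = B.actR y (B.iq x x)

/-- Compatibility in a biaction. -/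
def CompatX (B : Biaction S T X) (x y : X) : Prop := B.LCompatX x y ∧ B.RCompatX x y

/-- A compatible subset of `X`. -/
def CompatSetX (B : Biaction S T X) (A : Set X) : Prop := ∀ x ∈ A, ∀ y ∈ A, B.CompatX x y

/-- The order on `X`: `x ≤ y` iff `x = e • y` for some idempotent `e ∈ S`. -/
def bxle (B : Biaction S T X) (x y : X) : Prop := ∃ e : S, IsIdem e ∧ x = B.actL e y

/-- `j` is the join of `A ⊆ X`. -/
def IsJoinBX (B : Biaction S T X) (A : Set X) (j : X) : Prop :=
  (∀ a ∈ A, B.bxle a j) ∧ ∀ b : X, (∀ a ∈ A, B.bxle a b) → B.bxle j b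

end Biaction

/-- An `(S,T)`-bimodule over pseudogroups `S` and `T`. -/
structure Bimodule (S T : Type*) [Pseudogroup S] [Pseudogroup T] (X : Type*) extends
    Biaction S T X where
  joinsX : ∀ A : Set X, toBiaction.CompatSetX A → ∃ j : X, toBiaction.IsJoinBX A j
  distL : ∀ (s : S) (A : Set X) (j : X), toBiaction.CompatSetX A → toBiaction.IsJoinBX A j →
    toBiaction.IsJoinBX (toBiaction.actL s '' A) (toBiaction.actL s j)
  distSL : ∀ (A : Set S) (j : S), CompatSet A → IsJoin A j → ∀ x : X,
    toBiaction.IsJoinBX ((fun s => toBiaction.actL s x) '' A) (toBiaction.actL j x)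
  distR : ∀ (t : T) (A : Set X) (j : X), toBiaction.CompatSetX A → toBiaction.IsJoinBX A j →
    toBiaction.IsJoinBX ((fun x => toBiaction.actR x t) '' A) (toBiaction.actR j t)
  distTR : ∀ (A : Set T) (j : T), CompatSet A → IsJoin A j → ∀ x : X,
    toBiaction.IsJoinBX ((fun t => toBiaction.actR x t) '' A) (toBiaction.actR x j)
  distIP : ∀ (A : Set X) (j : X), toBiaction.CompatSetX A → toBiaction.IsJoinBX A j → ∀ y : X,
    IsJoin ((fun x => toBiaction.ip x y) '' A) (toBiaction.ip j y)
  distIQ : ∀ (A : Set X) (j : X), toBiaction.CompatSetX A → toBiaction.IsJoinBX A j → ∀ y : X,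
    IsJoin ((fun x => toBiaction.iq y x) '' A) (toBiaction.iq y j)

/-- An `(S,T)`-equivalence bimodule: an `(S,T)`-bimodule satisfying both covering
conditions `⋁_{x∈X} ⟨x,x⟩ = e_S` and `⋁_{x∈X} [x,x] = e_T`
(where `e_S = ⋁ E(S)` and `e_T = ⋁ E(T)`). -/
structure EquivBimodule (S T : Type*) [Pseudogroup S] [Pseudogroup T] (X : Type*) extends
    Bimodule S T X where
  coverS : ∀ jS : S, IsJoin {e : S | IsIdem e} jS →
    IsJoin (Set.range fun x : X => toBimodule.toBiaction.ip x x) jS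
  coverT : ∀ jT : T, IsJoin {e : T | IsIdem e} jT →
    IsJoin (Set.range fun x : X => toBimodule.toBiaction.iq x x) jT


section Aux

variable {S : Type*}

theorem aux_mul_idem [InverseSemigroup S] {e f : S} (he : IsIdem e) (hf : IsIdem f) :
    IsIdem (e * f) := by
  unfold IsIdem at *
  have he2 : ∀ y : S, e * (e * y) = e * y := fun y => by rw [← mul_assoc, he]
  have hf2 : ∀ y : S, f * (f * y) = f * y := fun y => by rw [← mul_assoc, hf]
  obtain ⟨x, hx⟩ : ∃ x : S, x = (e * f)⁻¹ := ⟨_, rfl⟩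
  have h1 := InverseSemigroup.mul_inv_mul (e * f)
  have h2 := InverseSemigroup.inv_mul_inv (e * f)
  rw [← hx] at h1 h2
  have h3 : f * x * e = x := by
    rw [hx]
    apply InverseSemigroup.inv_unique
    · rw [← hx]
      simp only [mul_assoc, he2, hf2] at h1 ⊢
      exact h1
    · rw [← hx]
      have : f * x * e * (e * f) * (f * x * e) = f * (x * (e * f) * x) * e := by
        simp only [mul_assoc, he2, hf2]
      rw [this, h2]
  have h4 : x * x = x := by
    calc x * x = (f * x * e) * (f * x * e) := by rw [h3]
      _ = f * (x * (e * f) * x) * e := by simp only [mul_assoc]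
      _ = x := by rw [h2, h3]
  have h5 : e * f = x⁻¹ := InverseSemigroup.inv_unique _ _ h2 h1
  have h6 : x = x⁻¹ := InverseSemigroup.inv_unique _ _ (by rw [h4, h4]) (by rw [h4, h4])
  rw [h5, ← h6, h4]

theorem aux_comm [InverseSemigroup S] {e f : S} (he : IsIdem e) (hf : IsIdem f) :
    e * f = f * e := by
  have h1 : (e * f) * (e * f) = e * f := aux_mul_idem he hf
  have h2 : (f * e) * (f * e) = f * e := aux_mul_idem hf he
  unfold IsIdem at he hf
  have he2 : ∀ y : S, e * (e * y) = e * y := fun y => by rw [← mul_assoc, he]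
  have hf2 : ∀ y : S, f * (f * y) = f * y := fun y => by rw [← mul_assoc, hf]
  have h3 : e * f = (e * f)⁻¹ :=
    InverseSemigroup.inv_unique _ _ (by rw [h1, h1]) (by rw [h1, h1])
  have h4 : f * e = (e * f)⁻¹ := by
    apply InverseSemigroup.inv_unique
    · simp only [mul_assoc, he2, hf2] at h1 ⊢
      exact h1
    · simp only [mul_assoc, he2, hf2] at h2 ⊢
      exact h2
  rw [h3, ← h4]

theorem aux_idem_r [InverseSemigroup S] (x : S) : IsIdem (x * x⁻¹) := by
  unfold IsIdem
  rw [← mul_assoc, InverseSemigroup.mul_inv_mul]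

theorem aux_inv [InverseSemigroup S] {e : S} (x : S) (he : IsIdem e) :
    (e * x)⁻¹ = x⁻¹ * e := by
  have hc := aux_comm he (aux_idem_r x)
  unfold IsIdem at he
  symm
  apply InverseSemigroup.inv_unique
  · calc e * x * (x⁻¹ * e) * (e * x) = e * (x * x⁻¹) * (e * e) * x := by
          simp only [mul_assoc]
      _ = e * e * (x * x⁻¹ * x) := by rw [he, mul_assoc e (x * x⁻¹) e, ← hc, ← mul_assoc, he]; simp only [mul_assoc]
      _ = e * x := by rw [he, InverseSemigroup.mul_inv_mul]
  · calc x⁻¹ * e * (e * x) * (x⁻¹ * e) = x⁻¹ * (e * e * (x * x⁻¹)) * e := by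
          simp only [mul_assoc]
      _ = x⁻¹ * x * x⁻¹ * (e * e) := by rw [he, hc]; simp only [mul_assoc, he]
      _ = x⁻¹ * e := by rw [he, InverseSemigroup.inv_mul_inv]

theorem aux_compat [InverseSemigroup S] {a b x : S} (ha : nle a x) (hb : nle b x) :
    Compat a b := by
  obtain ⟨e, he, rfl⟩ := ha
  obtain ⟨f, hf, rfl⟩ := hb
  constructor
  · unfold LeftCompat
    rw [aux_inv x he]
    have hg := aux_mul_idem he hf
    have hc := aux_comm hg (aux_idem_r x)
    have : x⁻¹ * e * (f * x) = x⁻¹ * (e * f) * x := by simp only [mul_assoc]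
    rw [this]
    generalize e * f = g at hg hc
    unfold IsIdem at *
    calc x⁻¹ * g * x * (x⁻¹ * g * x) = x⁻¹ * (g * (x * x⁻¹)) * g * x := by
          simp only [mul_assoc]
      _ = x⁻¹ * x * x⁻¹ * (g * g) * x := by rw [hc]; simp only [mul_assoc]
      _ = x⁻¹ * g * x := by rw [hg, InverseSemigroup.inv_mul_inv]
  · unfold RightCompat
    rw [aux_inv x hf]
    have : e * x * (x⁻¹ * f) = e * (x * x⁻¹) * f := by simp only [mul_assoc]
    rw [this]
    exact aux_mul_idem (aux_mul_idem he (aux_idem_r x)) hf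

theorem aux_trans [InverseSemigroup S] {a b c : S} (h : nle a b) (h' : nle b c) : nle a c := by
  obtain ⟨e, he, rfl⟩ := h
  obtain ⟨f, hf, rfl⟩ := h'
  exact ⟨e * f, aux_mul_idem he hf, (mul_assoc _ _ _).symm⟩

end Aux

/-- **Statement 14.** If `A` is a semigroup ideal of a pseudogroup `S`, then `A^∨`
(the set of joins of compatible subsets of `A`) is a sup-ideal of `S`. -/
theorem statement14 {S : Type*} [Pseudogroup S] (A : Set S) (hA : SemigroupIdeal A) :
    IsSupIdeal (supClosure A) := by
  refine ⟨?_, ?_⟩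
  · rintro s j ⟨C, hCA, hC, hj⟩
    have hl := Pseudogroup.mul_join_left s C j hC hj
    have hr := Pseudogroup.mul_join_right s C j hC hj
    refine ⟨⟨_, ?_, fun a ha b hb => aux_compat (hl.1 a ha) (hl.1 b hb), hl⟩,
      ⟨_, ?_, fun a ha b hb => aux_compat (hr.1 a ha) (hr.1 b hb), hr⟩⟩
    · rintro _ ⟨c, hc, rfl⟩
      exact (hA s c (hCA hc)).1
    · rintro _ ⟨c, hc, rfl⟩
      exact (hA s c (hCA hc)).2
  · intro C hCA _ j hj
    refine ⟨{a | a ∈ A ∧ nle a j}, fun a ha => ha.1,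
      fun a ha b hb => aux_compat ha.2 hb.2, fun a ha => ha.2, ?_⟩
    intro b hb
    apply hj.2
    intro c hc
    obtain ⟨D, hDA, _, hD⟩ := hCA hc
    exact hD.2 b fun d hd => hb d ⟨hDA hd, aux_trans (hD.1 d hd) (hj.1 c hc)⟩

end PseudogroupMorita
end

section
/- Let S and T be pseudogroups such that T is a sup-enlargement of S = eTe for an idempotent e ∈ E(T). Then every idempotent of TST = {t₁st₂ : t₁, t₂ ∈ T, s ∈ S} is 𝒟-related to an idempotent of S: if g ∈ TST is an idempotent, then there exists a ∈ T with a a⁻¹ = g and a⁻¹a ∈ E(S). -/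
namespace PseudogroupMorita

theorem mul_idem_aux {T : Type*} [InverseSemigroup T] {e f : T} (he : e * e = e)
    (hf : f * f = f) : (e * f) * (e * f) = e * f := by
  have he' : ∀ y : T, e * (e * y) = e * y := fun y => by rw [← mul_assoc, he]
  have hf' : ∀ y : T, f * (f * y) = f * y := fun y => by rw [← mul_assoc, hf]
  obtain ⟨x, hx⟩ : ∃ x : T, x = (e * f)⁻¹ := ⟨_, rfl⟩
  have h1 : e * (f * (x * (e * f))) = e * f := by
    have := InverseSemigroup.mul_inv_mul (e * f)
    rw [← hx] at this
    simpa only [mul_assoc] using this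
  have h2 : x * (e * (f * x)) = x := by
    have := InverseSemigroup.inv_mul_inv (e * f)
    rw [← hx] at this
    simpa only [mul_assoc] using this
  have h2' : ∀ y : T, x * (e * (f * (x * y))) = x * y := fun y => by
    have := congrArg (· * y) h2
    simpa only [mul_assoc] using this
  have h3 : f * x * e = x := by
    rw [hx]
    apply InverseSemigroup.inv_unique
    · rw [← hx]; simp only [mul_assoc, he', hf', h1]
    · rw [← hx]; simp only [mul_assoc, he', hf', h2']
  have h4 : x * x = x := by
    calc x * x = (f * x * e) * (f * x * e) := by rw [h3]
      _ = f * x * e := by simp only [mul_assoc, h2']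
      _ = x := h3
  have h5 : e * f = x⁻¹ := by
    apply InverseSemigroup.inv_unique
    · simpa only [mul_assoc] using h2
    · simpa only [mul_assoc] using h1
  have h6 : x = x⁻¹ := by
    apply InverseSemigroup.inv_unique <;> rw [h4, h4]
  rw [h5, ← h6, h4]

theorem idem_comm_aux {T : Type*} [InverseSemigroup T] {e f : T} (he : e * e = e)
    (hf : f * f = f) : e * f = f * e := by
  have h1 := mul_idem_aux he hf
  have h2 := mul_idem_aux hf he
  have he' : ∀ y : T, e * (e * y) = e * y := fun y => by rw [← mul_assoc, he]
  have hf' : ∀ y : T, f * (f * y) = f * y := fun y => by rw [← mul_assoc, hf]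
  have h3 : e * f = (e * f)⁻¹ := by
    apply InverseSemigroup.inv_unique <;> rw [h1, h1]
  have h4 : f * e = (e * f)⁻¹ := by
    simp only [mul_assoc] at h1 h2
    apply InverseSemigroup.inv_unique
    · simp only [mul_assoc, he', hf', h1]
    · simp only [mul_assoc, he', hf', h2]
  rw [h3, ← h4]

/-- **Statement 17.** Let `T` be a pseudogroup which is a sup-enlargement of `S = eTe`.
Then every idempotent `g` of `TST` is `𝒟`-related to an idempotent of `S`: there is
`a ∈ T` with `a a⁻¹ = g` and `a⁻¹ a` an idempotent of `S = eTe`. -/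
theorem statement17 {T : Type*} [Pseudogroup T] (e : T) (he : IsIdem e)
    (hE1 : locSet e = tripleProd (locSet e) Set.univ (locSet e))
    (hE2 : (Set.univ : Set T) = supClosure (tripleProd Set.univ (locSet e) Set.univ))
    (g : T) (hg : g ∈ tripleProd Set.univ (locSet e) Set.univ) (hgi : IsIdem g) :
    ∃ a : T, a * a⁻¹ = g ∧ IsIdem (a⁻¹ * a) ∧ a⁻¹ * a ∈ locSet e := by
  obtain ⟨t, -, s, hs, u, -, hgt⟩ := hg
  have hs : s = e * s * e := hs
  have he : e * e = e := he
  have hgi : g * g = g := hgi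
  have hes : e * s = s := by
    rw [hs]; simp only [← mul_assoc, he]
  have htt : (t⁻¹ * t) * (t⁻¹ * t) = t⁻¹ * t := by
    rw [← mul_assoc, InverseSemigroup.inv_mul_inv]
  have hc := idem_comm_aux he htt
  have key : t * e * t⁻¹ * g = g := by
    calc t * e * t⁻¹ * g = t * (e * (t⁻¹ * t)) * s * u := by rw [hgt]; simp only [mul_assoc]
      _ = (t * t⁻¹ * t) * (e * s) * u := by rw [hc]; simp only [mul_assoc]
      _ = g := by rw [InverseSemigroup.mul_inv_mul, hes, hgt]
  have hab : (g * t * e) * (e * t⁻¹ * g) = g := by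
    calc (g * t * e) * (e * t⁻¹ * g) = g * (t * (e * e) * t⁻¹ * g) := by simp only [mul_assoc]
      _ = g := by rw [he, key, hgi]
  have hinv : e * t⁻¹ * g = (g * t * e)⁻¹ := by
    apply InverseSemigroup.inv_unique
    · rw [hab]; simp only [← mul_assoc, hgi]
    · rw [mul_assoc, hab, mul_assoc, hgi]
  refine ⟨g * t * e, ?_, ?_, ?_⟩
  · rw [← hinv, hab]
  · show _ * _ = _
    rw [← mul_assoc, InverseSemigroup.inv_mul_inv]
  · rw [← hinv]
    show _ = _
    have he' : ∀ y : T, e * (e * y) = e * y := fun y => by rw [← mul_assoc, he]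
    simp only [mul_assoc, he, he']

end PseudogroupMorita
end

section
/- Let T be a pseudogroup that is a sup-enlargement of the pseudogroup S = eTe for an idempotent e ∈ E(T). Then S is 0-simplifying if and only if T is 0-simplifying. (Consequently, being 0-simplifying is a Morita invariant of pseudogroups: Morita equivalent pseudogroups, equivalently pseudogroups with a joint sup-enlargement, are simultaneously 0-simplifying.) -/
namespace PseudogroupMorita

section Helpers

variable {T : Type*}

theorem idem_inv [InverseSemigroup T] {f : T} (hf : IsIdem f) : f⁻¹ = f := by
  have h : f * f = f := hf
  exact (InverseSemigroup.inv_unique f f (by rw [h, h]) (by rw [h, h])).symm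

theorem inv_inv_aux [InverseSemigroup T] (a : T) : a⁻¹⁻¹ = a :=
  (InverseSemigroup.inv_unique a⁻¹ a (InverseSemigroup.inv_mul_inv a)
    (InverseSemigroup.mul_inv_mul a)).symm

theorem idem_mul_idem [InverseSemigroup T] {f g : T} (hf : IsIdem f) (hg : IsIdem g) :
    IsIdem (f * g) := by
  have hf' : f * f = f := hf
  have hg' : g * g = g := hg
  obtain ⟨x, hx⟩ : ∃ x, x = (f * g)⁻¹ := ⟨_, rfl⟩
  have h1 : f * g * x * (f * g) = f * g := by rw [hx]; exact InverseSemigroup.mul_inv_mul _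
  have h2 : x * (f * g) * x = x := by rw [hx]; exact InverseSemigroup.inv_mul_inv _
  have e1 : g * x * f = (f * g)⁻¹ := by
    apply InverseSemigroup.inv_unique
    · calc f * g * (g * x * f) * (f * g) = f * (g * g) * x * ((f * f) * g) := by
            simp only [mul_assoc]
        _ = f * g := by rw [hf', hg', h1]
    · calc g * x * f * (f * g) * (g * x * f) = g * (x * ((f * f) * (g * g)) * x) * f := by
            simp only [mul_assoc]
        _ = g * x * f := by rw [hf', hg', h2]
  have hid : IsIdem (g * x * f) := by
    show g * x * f * (g * x * f) = g * x * f
    calc g * x * f * (g * x * f) = g * (x * (f * g) * x) * f := by simp only [mul_assoc]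
      _ = _ := by rw [h2]
  have h3 : f * g = g * x * f := by
    rw [← inv_inv_aux (f * g), ← e1, idem_inv hid]
  rw [h3]; exact hid

theorem idem_comm [InverseSemigroup T] {f g : T} (hf : IsIdem f) (hg : IsIdem g) :
    f * g = g * f := by
  have hf' : f * f = f := hf
  have hg' : g * g = g := hg
  have h1 : f * g * (f * g) = f * g := idem_mul_idem hf hg
  have h2 : g * f * (g * f) = g * f := idem_mul_idem hg hf
  have : g * f = (f * g)⁻¹ := by
    apply InverseSemigroup.inv_unique
    · calc f * g * (g * f) * (f * g) = f * (g * g) * ((f * f) * g) := by simp only [mul_assoc]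
        _ = f * g := by rw [hf', hg', h1]
    · calc g * f * (f * g) * (g * f) = g * (f * f) * ((g * g) * f) := by simp only [mul_assoc]
        _ = g * f := by rw [hf', hg', h2]
  rw [this, idem_inv (idem_mul_idem hf hg)]

theorem idem_mul_inv [InverseSemigroup T] (a : T) : IsIdem (a * a⁻¹) := by
  show a * a⁻¹ * (a * a⁻¹) = a * a⁻¹
  rw [← mul_assoc, InverseSemigroup.mul_inv_mul]

theorem idem_inv_mul [InverseSemigroup T] (a : T) : IsIdem (a⁻¹ * a) := by
  show a⁻¹ * a * (a⁻¹ * a) = a⁻¹ * a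
  rw [← mul_assoc, InverseSemigroup.inv_mul_inv]

/-- The inverse of `f * b` for `f` idempotent. -/
theorem inv_idem_mul [InverseSemigroup T] {f : T} (hf : IsIdem f) (b : T) :
    (f * b)⁻¹ = b⁻¹ * f := by
  have hf' : f * f = f := hf
  symm
  have hc := idem_comm hf (idem_mul_inv b)
  apply InverseSemigroup.inv_unique
  · calc f * b * (b⁻¹ * f) * (f * b) = f * ((b * b⁻¹) * (f * f)) * b := by
          simp only [mul_assoc]
      _ = (f * f) * (b * b⁻¹ * b) := by rw [hf', ← hc]; simp only [← mul_assoc, hf']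
      _ = f * b := by rw [hf', InverseSemigroup.mul_inv_mul]
  · calc b⁻¹ * f * (f * b) * (b⁻¹ * f) = b⁻¹ * ((f * f) * (b * b⁻¹)) * f := by
          simp only [mul_assoc]
      _ = (b⁻¹ * b * b⁻¹) * (f * f) := by rw [hf', hc]; simp only [mul_assoc, hf']
      _ = b⁻¹ * f := by rw [hf', InverseSemigroup.inv_mul_inv]

theorem nle_antisymm [InverseSemigroup T] {a b : T} (h1 : nle a b) (h2 : nle b a) : a = b := by
  obtain ⟨f, hf, ha⟩ := h1
  obtain ⟨g, hg, hb⟩ := h2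
  have hf' : f * f = f := hf
  have hfa : f * a = a := by
    calc f * a = (f * f) * b := by rw [ha]; simp only [mul_assoc]
      _ = a := by rw [hf', ← ha]
  calc a = f * (g * a) := by rw [← hb, ← ha]
    _ = g * (f * a) := by rw [← mul_assoc, idem_comm hf hg, mul_assoc]
    _ = b := by rw [hfa, ← hb]

theorem nle_refl [InverseSemigroup T] (a : T) : nle a a :=
  ⟨a * a⁻¹, idem_mul_inv a, (InverseSemigroup.mul_inv_mul a).symm⟩

theorem join_unique [InverseSemigroup T] {A : Set T} {i j : T} (h1 : IsJoin A i)
    (h2 : IsJoin A j) : i = j :=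
  nle_antisymm (h1.2 _ h2.1) (h2.2 _ h1.1)

theorem compat_of_nle [InverseSemigroup T] {a b j : T} (h1 : nle a j) (h2 : nle b j) :
    Compat a b := by
  obtain ⟨f, hf, rfl⟩ := h1
  obtain ⟨g, hg, rfl⟩ := h2
  have hfg : IsIdem (f * g) := idem_mul_idem hf hg
  have hfg' : f * g * (f * g) = f * g := hfg
  constructor
  · show (f * j)⁻¹ * (g * j) * ((f * j)⁻¹ * (g * j)) = (f * j)⁻¹ * (g * j)
    rw [inv_idem_mul hf]
    calc j⁻¹ * f * (g * j) * (j⁻¹ * f * (g * j))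
        = j⁻¹ * (f * g * (j * j⁻¹)) * (f * g) * j := by simp only [mul_assoc]
      _ = (j⁻¹ * j * j⁻¹) * (f * g * (f * g)) * j := by
          rw [idem_comm hfg (idem_mul_inv j)]; simp only [mul_assoc]
      _ = j⁻¹ * f * (g * j) := by
          rw [hfg', InverseSemigroup.inv_mul_inv]; simp only [mul_assoc]
  · show IsIdem (f * j * (g * j)⁻¹)
    rw [inv_idem_mul hg]
    have : f * j * (j⁻¹ * g) = f * (j * j⁻¹ * g) := by simp only [mul_assoc]
    rw [this]
    exact idem_mul_idem hf (idem_mul_idem (idem_mul_inv j) hg)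

theorem compatSet_of_join [InverseSemigroup T] {A : Set T} {j : T} (h : IsJoin A j) :
    CompatSet A := fun a ha b hb => compat_of_nle (h.1 a ha) (h.1 b hb)

theorem join_mul_mul [Pseudogroup T] {A : Set T} {j : T} (h : IsJoin A j) (s t : T) :
    IsJoin ((fun a => s * a * t) '' A) (s * j * t) := by
  have h1 := Pseudogroup.mul_join_left s A j (compatSet_of_join h) h
  have h2 := Pseudogroup.mul_join_right t _ _ (compatSet_of_join h1) h1
  rwa [Set.image_image] at h2

theorem zero_mul_aux [Pseudogroup T] {z : T} (hz : IsJoin (∅ : Set T) z) (s : T) :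
    z * s = z := by
  have h := Pseudogroup.mul_join_right s _ _ (compatSet_of_join hz) hz
  rw [Set.image_empty] at h
  exact join_unique h hz

theorem mul_zero_aux [Pseudogroup T] {z : T} (hz : IsJoin (∅ : Set T) z) (s : T) :
    s * z = z := by
  have h := Pseudogroup.mul_join_left s _ _ (compatSet_of_join hz) hz
  rw [Set.image_empty] at h
  exact join_unique h hz

end Helpers

/-- **Statement 18.** Let `T` be a pseudogroup which is a sup-enlargement of `S = eTe`,
and let `z` be the least element (of both). Then `S` is 0-simplifying iff `T` is
0-simplifying. -/
theorem statement18 {T : Type*} [Pseudogroup T] (z : T) (hz : IsJoin (∅ : Set T) z)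
    (e : T) (he : IsIdem e)
    (hE1 : locSet e = tripleProd (locSet e) Set.univ (locSet e))
    (hE2 : (Set.univ : Set T) = supClosure (tripleProd Set.univ (locSet e) Set.univ)) :
    ZeroSimplifyingIn (locSet e) z ↔ ZeroSimplifyingIn (Set.univ : Set T) z := by
  have he' : e * e = e := he
  constructor
  · intro hS I hI
    obtain ⟨-, hId, hJn⟩ := hI
    have hzI : z ∈ I := hJn ∅ (Set.empty_subset _) (compatSet_of_join hz) z hz
    have hsub : IsSupIdealIn (locSet e) (I ∩ locSet e) := by
      refine ⟨Set.inter_subset_right, ?_, ?_⟩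
      · rintro s hs a ⟨haI, haS⟩
        have hs' : s = e * s * e := hs
        have ha' : a = e * a * e := haS
        have es : e * s = s := by
          rw [hs']; simp only [← mul_assoc, he']
        have se : s * e = s := by
          rw [hs']; simp only [mul_assoc, he']
        have ea : e * a = a := by
          rw [ha']; simp only [← mul_assoc, he']
        have ae : a * e = a := by
          rw [ha']; simp only [mul_assoc, he']
        refine ⟨⟨(hId s trivial a haI).1, ?_⟩, ⟨(hId s trivial a haI).2, ?_⟩⟩
        · show s * a = e * (s * a) * e
          rw [← mul_assoc, es, mul_assoc, ae]
        · show a * s = e * (a * s) * e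
          rw [← mul_assoc, ea, mul_assoc, se]
      · intro C hC hCc j hj
        refine ⟨hJn C (fun c hc => (hC hc).1) hCc j hj, ?_⟩
        have h := join_mul_mul hj e e
        have himg : (fun a => e * a * e) '' C = C := by
          calc (fun a => e * a * e) '' C = id '' C :=
                Set.image_congr (fun c hc => ((hC hc).2 : c = e * c * e).symm)
            _ = C := Set.image_id C
        rw [himg] at h
        exact join_unique hj h
    rcases hS _ hsub with h | h
    · left
      ext x
      constructor
      · intro hx
        have hxx : x * x⁻¹ ∈ supClosure (tripleProd Set.univ (locSet e) Set.univ) := by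
          rw [← hE2]; trivial
        obtain ⟨C, hC, hCc, hCj⟩ := hxx
        have hj := Pseudogroup.mul_join_right x C _ hCc hCj
        rw [InverseSemigroup.mul_inv_mul] at hj
        have key : nle x z := by
          apply hj.2
          rintro _ ⟨c, hc, rfl⟩
          obtain ⟨a, -, s, hs, b, -, rfl⟩ := hC hc
          have hs' : s = e * s * e := hs
          have se : s * e = s := by
            rw [hs']; simp only [mul_assoc, he']
          obtain ⟨y, hy⟩ : ∃ y, y = e * b * x := ⟨_, rfl⟩
          have hyI : y ∈ I := by rw [hy]; exact (hId _ trivial x hx).1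
          have ey : e * y = y := by rw [hy]; simp only [← mul_assoc, he']
          have hm : e * (y * y⁻¹) * e ∈ I ∩ locSet e := by
            refine ⟨(hId _ trivial _ (hId _ trivial _ (hId _ trivial y hyI).2).1).2, ?_⟩
            show e * (y * y⁻¹) * e = e * (e * (y * y⁻¹) * e) * e
            simp only [mul_assoc, he']
            simp only [← mul_assoc, he']
          rw [h] at hm
          have hm' : e * (y * y⁻¹) * e = z := hm
          have hyz : y = z := by
            calc y = e * (y * y⁻¹ * y) := by rw [InverseSemigroup.mul_inv_mul, ey]
              _ = e * (y * y⁻¹) * (e * y) := by rw [ey]; simp only [mul_assoc]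
              _ = e * (y * y⁻¹) * e * y := by simp only [mul_assoc]
              _ = z := by rw [hm', zero_mul_aux hz]
          have : a * s * b * x = z := by
            calc a * s * b * x = a * (s * e) * b * x := by rw [se]
              _ = a * s * y := by rw [hy]; simp only [mul_assoc]
              _ = z := by rw [hyz, mul_zero_aux hz]
          show nle (a * s * b * x) z
          rw [this]
          exact nle_refl z
        exact nle_antisymm key (hz.2 x (fun a ha => absurd ha (Set.notMem_empty a)))
      · intro hx
        have hx' : x = z := hx
        rw [hx']; exact hzI
    · right
      apply Set.eq_univ_of_forall
      intro x
      have hx : x ∈ supClosure (tripleProd Set.univ (locSet e) Set.univ) := by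
        rw [← hE2]; trivial
      obtain ⟨C, hC, hCc, hCj⟩ := hx
      refine hJn C ?_ hCc x hCj
      intro c hc
      obtain ⟨a, -, s, hs, b, -, rfl⟩ := hC hc
      rw [← h] at hs
      exact (hId _ trivial _ (hId _ trivial s hs.1).1).2
  · intro hT J hJ
    obtain ⟨hJS, hId, hJn⟩ := hJ
    have hzJ : z ∈ J := hJn ∅ (Set.empty_subset _) (compatSet_of_join hz) z hz
    have hloc : ∀ a : T, e * a * e ∈ locSet e := by
      intro a
      show e * a * e = e * (e * a * e) * e
      simp only [mul_assoc, he']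
      simp only [← mul_assoc, he']
    have hI : IsSupIdealIn (Set.univ : Set T) {t | ∀ a b : T, e * a * t * (b * e) ∈ J} := by
      refine ⟨Set.subset_univ _, ?_, ?_⟩
      · intro s _ t ht
        constructor
        · intro a b
          have h := ht (a * s) b
          simp only [mul_assoc] at h ⊢
          exact h
        · intro a b
          have h := ht a (s * b)
          simp only [mul_assoc] at h ⊢
          exact h
      · intro C hC _ j hj a b
        have h := join_mul_mul hj (e * a) (b * e)
        refine hJn _ ?_ (compatSet_of_join h) _ h
        rintro _ ⟨c, hc, rfl⟩
        exact hC hc a b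
    rcases hT _ hI with h | h
    · left
      ext x
      constructor
      · intro hx
        rw [← h]
        intro a b
        have hx' : x = e * x * e := hJS hx
        have : e * a * x * (b * e) = e * a * e * x * (e * b * e) := by
          conv_lhs => rw [hx']
          simp only [mul_assoc]
        rw [this]
        exact (hId _ (hloc b) _ (hId _ (hloc a) x hx).1).2
      · intro hx
        have hx' : x = z := hx
        rw [hx']; exact hzJ
    · right
      apply Set.Subset.antisymm hJS
      intro s hs
      have h1 : e ∈ {t | ∀ a b : T, e * a * t * (b * e) ∈ J} := by rw [h]; trivial
      have h2 := h1 e e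
      rw [he', he', he'] at h2
      have hs' : s = e * s * e := hs
      have se : s * e = s := by
        rw [hs']; simp only [mul_assoc, he']
      rw [← se]
      exact (hId s hs e h2).1

end PseudogroupMorita
end

section
/- Let T be a pseudogroup that is a sup-enlargement of the pseudogroup S = eTe for an idempotent e ∈ E(T). Then S is fundamental if and only if T is fundamental. -/
namespace PseudogroupMorita

section helpers

variable {S : Type*} [InverseSemigroup S]

theorem aux_idem_mul {e f : S} (he : e * e = e) (hf : f * f = f) :
    e * f * (e * f) = e * f := by
  have h1 := InverseSemigroup.mul_inv_mul (e * f)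
  have h2 := InverseSemigroup.inv_mul_inv (e * f)
  have h3 := InverseSemigroup.inv_unique (e * f)
  have h4 := InverseSemigroup.inv_unique (e * f)⁻¹
  generalize (e * f)⁻¹ = a at h1 h2 h3 h4
  have he' : ∀ x, e * (e * x) = e * x := fun x => by rw [← mul_assoc, he]
  have hf' : ∀ x, f * (f * x) = f * x := fun x => by rw [← mul_assoc, hf]
  have h2' : ∀ x, a * (e * (f * (a * x))) = a * x := fun x => by
    conv_rhs => rw [← h2]
    simp only [mul_assoc]
  simp only [mul_assoc] at h1 h2
  have h5 : f * a * e = a := by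
    apply h3
    · simp only [mul_assoc, he', hf', h1]
    · simp only [mul_assoc, he', hf', h2']
  have h6 : a * a = a := by
    conv_lhs => rw [← h5]
    simp only [mul_assoc, h2']
    rw [← mul_assoc, h5]
  have h7 : a = a⁻¹ := h4 a (by rw [h6, h6]) (by rw [h6, h6])
  have h8 : e * f = a⁻¹ := h4 _ (by simp only [mul_assoc, h2]) (by simp only [mul_assoc, h1])
  rw [h8, ← h7, h6]

theorem aux_idem_comm {e f : S} (he : e * e = e) (hf : f * f = f) : e * f = f * e := by
  have h1 := aux_idem_mul he hf
  have h2 := aux_idem_mul hf he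
  have he' : ∀ x, e * (e * x) = e * x := fun x => by rw [← mul_assoc, he]
  have hf' : ∀ x, f * (f * x) = f * x := fun x => by rw [← mul_assoc, hf]
  have h3 : f * e = (e * f)⁻¹ := by
    apply InverseSemigroup.inv_unique
    · simp only [mul_assoc, he', hf'] at h1 ⊢
      exact h1
    · simp only [mul_assoc, he', hf'] at h2 ⊢
      exact h2
  have h4 : e * f = (e * f)⁻¹ := by
    apply InverseSemigroup.inv_unique
    · rw [h1, h1]
    · rw [h1, h1]
  rw [h3, ← h4]

theorem aux_mul_inv_idem (a : S) : (a * a⁻¹) * (a * a⁻¹) = a * a⁻¹ := by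
  rw [← mul_assoc, InverseSemigroup.mul_inv_mul]

theorem aux_inv_mul_idem (a : S) : (a⁻¹ * a) * (a⁻¹ * a) = a⁻¹ * a := by
  rw [← mul_assoc, InverseSemigroup.inv_mul_inv]

/-- An element of `TeT`, commuting with all idempotents, is idempotent if `eTe` is fundamental. -/
theorem aux_key {e : S} (he : e * e = e) (hS : FundamentalIn (locSet e)) {c x y : S}
    (hx : x * e = x) (hc : c = x * y) (hcomm : ∀ g : S, IsIdem g → c * g = g * c) :
    IsIdem c := by
  have hxi : e * x⁻¹ = x⁻¹ := by
    apply InverseSemigroup.inv_unique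
    · rw [← mul_assoc, hx, InverseSemigroup.mul_inv_mul]
    · rw [mul_assoc, mul_assoc, ← mul_assoc x e, hx, ← mul_assoc x⁻¹,
        InverseSemigroup.inv_mul_inv]
  have hxx : x * x⁻¹ * c = c := by
    rw [hc, ← mul_assoc, InverseSemigroup.mul_inv_mul]
  have hu : IsIdem (x⁻¹ * c * x) := by
    apply hS
    · change x⁻¹ * c * x = e * (x⁻¹ * c * x) * e
      simp only [← mul_assoc]
      rw [hxi, mul_assoc _ x e, hx]
    · intro g _ hg
      have hg1 : g * (x⁻¹ * x) = x⁻¹ * x * g := aux_idem_comm hg (aux_inv_mul_idem x)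
      have hgx : x * g = x * g * x⁻¹ * x := by
        rw [mul_assoc (x * g), mul_assoc x, hg1, ← mul_assoc, ← mul_assoc,
          InverseSemigroup.mul_inv_mul]
      have hgi : IsIdem (x * g * x⁻¹) := by
        change x * g * x⁻¹ * (x * g * x⁻¹) = x * g * x⁻¹
        rw [← mul_assoc, ← mul_assoc, ← hgx, mul_assoc x g g, hg]
      calc x⁻¹ * c * x * g = x⁻¹ * (c * (x * g * x⁻¹)) * x := by
            rw [mul_assoc (x⁻¹ * c)]; conv_lhs => rw [hgx]
            simp only [mul_assoc]
        _ = x⁻¹ * ((x * g * x⁻¹) * c) * x := by rw [hcomm _ hgi]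
        _ = (x⁻¹ * x * g) * (x⁻¹ * c * x) := by simp only [mul_assoc]
        _ = g * (x⁻¹ * x * x⁻¹) * (c * x) := by rw [← hg1]; simp only [mul_assoc]
        _ = g * (x⁻¹ * c * x) := by rw [InverseSemigroup.inv_mul_inv]; simp only [mul_assoc]
  have hc2 : c = x * (x⁻¹ * c * x) * x⁻¹ := by
    calc c = x * x⁻¹ * c := hxx.symm
      _ = x * x⁻¹ * (x * x⁻¹ * c) := by rw [hxx, hxx]
      _ = x * x⁻¹ * (c * (x * x⁻¹)) := by rw [hcomm _ (aux_mul_inv_idem x)]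
      _ = _ := by simp only [mul_assoc]
  have hux : x⁻¹ * x * (x⁻¹ * c * x) = x⁻¹ * c * x := by
    rw [← mul_assoc, ← mul_assoc, InverseSemigroup.inv_mul_inv]
  generalize x⁻¹ * c * x = u at hu hc2 hux
  change c * c = c
  calc c * c = x * u * x⁻¹ * (x * u * x⁻¹) := by rw [← hc2]
    _ = x * (u * (x⁻¹ * x * u)) * x⁻¹ := by simp only [mul_assoc]
    _ = x * u * x⁻¹ := by rw [hux, hu]
    _ = c := hc2.symm

end helpers

/-- **Statement 19.** Let `T` be a pseudogroup which is a sup-enlargement of `S = eTe`.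
Then `S` is fundamental iff `T` is fundamental. -/
theorem statement19 {T : Type*} [Pseudogroup T] (e : T) (he : IsIdem e)
    (hE1 : locSet e = tripleProd (locSet e) Set.univ (locSet e))
    (hE2 : (Set.univ : Set T) = supClosure (tripleProd Set.univ (locSet e) Set.univ)) :
    FundamentalIn (locSet e) ↔ FundamentalIn (Set.univ : Set T) := by
  constructor
  · intro hS t _ ht
    have ht' : ∀ g : T, IsIdem g → t * g = g * t := fun g hg => ht g (Set.mem_univ g) hg
    have hmem : t ∈ supClosure (tripleProd Set.univ (locSet e) Set.univ) := by
      rw [← hE2]; exact Set.mem_univ t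
    obtain ⟨C, hC, _, hj1, hj2⟩ := hmem
    have htt : IsIdem (t * t⁻¹) := aux_mul_inv_idem t
    obtain ⟨g, hg, hgt⟩ := hj2 (t * t⁻¹) (by
      intro c hc
      obtain ⟨f, hf, hcf⟩ := hj1 c hc
      obtain ⟨a, _, s, hs, b, _, hcs⟩ := hC hc
      have hci : IsIdem c := by
        refine aux_key (x := a * e) (y := s * b) he hS ?_ ?_ ?_
        · rw [mul_assoc, he]
        · have hs' : s = e * s * e := hs
          have hes : e * s = s := by
            rw [hs', ← mul_assoc, ← mul_assoc, he]
          rw [hcs, mul_assoc a e, ← mul_assoc e, hes, mul_assoc]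
        · intro g hg
          rw [hcf, mul_assoc, ht' g hg, ← mul_assoc, aux_idem_comm hf hg, mul_assoc]
      refine ⟨c, hci, ?_⟩
      conv_rhs => rw [hcf]
      rw [mul_assoc, ht' _ htt, InverseSemigroup.mul_inv_mul]
      exact hcf)
    have := aux_idem_mul hg htt
    rw [← hgt] at this
    exact this
  · intro hT a ha hcomm
    have ha' : a = e * a * e := ha
    have hae : a * e = a := by rw [ha', mul_assoc, he]
    have hea : e * a = a := by rw [ha', ← mul_assoc, ← mul_assoc, he]
    refine hT a (Set.mem_univ a) ?_
    intro g _ hg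
    have hge := aux_idem_comm hg he
    have hk := hcomm (e * g) (by
      change e * g = e * (e * g) * e
      rw [← mul_assoc, he, mul_assoc, hge, ← mul_assoc, he]) (aux_idem_mul he hg)
    rw [← mul_assoc, hae, ← hge, mul_assoc, hea] at hk
    exact hk

end PseudogroupMorita
end
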